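/- arXiv:1612.05915 — 2 statements merged into one kernel-verified Lean document; each statement's English description precedes it below -/
import Mathlib

section
/- Let G be a discrete group, and let ω be a weight on G. If the augmentation ideal ℓ¹₀(G, ω) is finitely-generated as a left ideal of ℓ¹(G, ω), then G is finitely generated as a group. -/
noncomputable section

open scoped BigOperators

variable {M : Type*}

/-- Convolution of two functions on a (discrete) monoid/group:
`(f ∗ g)(u) = ∑_{st = u} f(s) g(t)`. -/
def conv [Mul M] (f g : M → ℂ) : M → ℂ :=
  fun u => ∑' p : {p : M × M // p.1 * p.2 = u}, f (p : M × M).1 * g (p : M × M).2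

/-- The weighted space `ℓ¹(M, ω)`, as a set of functions `M → ℂ`. -/
def l1w (ω : M → ℝ) : Set (M → ℂ) := {f | Summable fun u => ‖f u‖ * ω u}

/-- The augmentation ideal `ℓ¹₀(M, ω) = {f ∈ ℓ¹(M, ω) : ∑_u f(u) = 0}`. -/
def l1w0 (ω : M → ℝ) : Set (M → ℂ) := {f ∈ l1w ω | ∑' u, f u = 0}

/-- `ω` is a weight on the monoid `M`. -/
def IsWeight [Monoid M] (ω : M → ℝ) : Prop :=
  (∀ u, 1 ≤ ω u) ∧ ω 1 = 1 ∧ ∀ u v, ω (u * v) ≤ ω u * ω v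

/-- `I` is finitely generated as a left ideal of `ℓ¹(M, ω)`:
`I = A♯x₁ + ⋯ + A♯xₙ` for some `x₁, …, xₙ ∈ A = ℓ¹(M, ω)`, where `A♯` is the
(conditional) unitisation, so `A♯x = {a ∗ x + c x : a ∈ A, c ∈ ℂ}`;
no closure is taken. -/
def IsFinGenLeftIdealOf [Mul M] (ω : M → ℝ) (I : Set (M → ℂ)) : Prop :=
  ∃ (n : ℕ) (x : Fin n → (M → ℂ)), (∀ i, x i ∈ l1w ω) ∧
    I = {f | ∃ (a : Fin n → (M → ℂ)) (c : Fin n → ℂ), (∀ i, a i ∈ l1w ω) ∧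
          f = ∑ i, (conv (a i) (x i) + c i • x i)}

section helpers

variable {G : Type*} [Group G]

/-- infimum of the weight over the left coset `gH` -/
def wq (ω : G → ℝ) (H : Subgroup G) (g : G) : ℝ := ⨅ h : H, ω (g * h)

/-- sum over the left coset `gH` -/
def csum (H : Subgroup G) (f : G → ℂ) (g : G) : ℂ := ∑' h : H, f (g * h)

lemma wq_bdd {ω : G → ℝ} (hω : IsWeight ω) (H : Subgroup G) (g : G) :
    BddBelow (Set.range fun h : H => ω (g * h)) :=
  ⟨0, by rintro _ ⟨h, rfl⟩; exact zero_le_one.trans (hω.1 _)⟩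

lemma wq_le {ω : G → ℝ} (hω : IsWeight ω) (H : Subgroup G) (g : G) (h : H) :
    wq ω H g ≤ ω (g * h) := ciInf_le (wq_bdd hω H g) h

lemma one_le_wq {ω : G → ℝ} (hω : IsWeight ω) (H : Subgroup G) (g : G) :
    1 ≤ wq ω H g := le_ciInf fun h => hω.1 _

lemma wq_mul {ω : G → ℝ} (hω : IsWeight ω) (H : Subgroup G) (u g : G) :
    wq ω H (u * g) ≤ ω u * wq ω H g := by
  have hu : 0 < ω u := zero_lt_one.trans_le (hω.1 u)
  rw [← div_le_iff₀' hu]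
  refine le_ciInf fun h => ?_
  rw [div_le_iff₀' hu]
  refine (wq_le hω H _ h).trans ?_
  rw [mul_assoc]
  exact hω.2.2 _ _

lemma norm_summable {ω : G → ℝ} (hω : IsWeight ω) {f : G → ℂ} (hf : f ∈ l1w ω) :
    Summable fun u => ‖f u‖ :=
  Summable.of_nonneg_of_le (fun u => norm_nonneg _)
    (fun u => le_mul_of_one_le_right (norm_nonneg _) (hω.1 u)) hf

lemma coset_inj (H : Subgroup G) (g : G) : Function.Injective fun h : H => g * (h : G) :=
  fun a b hab => Subtype.ext (mul_left_cancel hab)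

lemma conv_eq (a x : G → ℂ) (w : G) : conv a x w = ∑' u, a u * x (u⁻¹ * w) := by
  unfold conv
  let e : G ≃ {p : G × G // p.1 * p.2 = w} :=
    { toFun := fun u => ⟨(u, u⁻¹ * w), by simp⟩
      invFun := fun p => p.1.1
      left_inv := fun u => rfl
      right_inv := by
        rintro ⟨⟨p, q⟩, h⟩
        simp only [Subtype.mk.injEq, Prod.mk.injEq, true_and]
        simp only at h
        rw [← h]; simp }
  rw [← e.tsum_eq]
  rfl

lemma prod_summable {a x : G → ℂ} (ha : Summable fun u => ‖a u‖) (hx : Summable fun u => ‖x u‖)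
    (H : Subgroup G) (g : G) :
    Summable (Function.uncurry fun (h : H) (u : G) => a u * x (u⁻¹ * (g * h))) := by
  have h1 := summable_mul_of_summable_norm ha hx
  have hi : Function.Injective fun p : H × G => (p.2, p.2⁻¹ * (g * (p.1 : G))) := by
    rintro ⟨h, u⟩ ⟨h', u'⟩ hh
    have hu : u = u' := congrArg Prod.fst hh
    have hh2 : u⁻¹ * (g * (h : G)) = u'⁻¹ * (g * (h' : G)) := congrArg Prod.snd hh
    subst hu
    have hh3 : h = h' := Subtype.ext (mul_left_cancel (mul_left_cancel hh2))
    rw [hh3]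
  have h2 := h1.comp_injective hi
  refine h2.congr fun p => ?_
  obtain ⟨h, u⟩ := p
  simp only [Function.comp, Function.uncurry]

lemma conv_summable {a x : G → ℂ} (ha : Summable fun u => ‖a u‖) (hx : Summable fun u => ‖x u‖)
    (H : Subgroup G) (g : G) : Summable fun h : H => conv a x (g * h) := by
  simp_rw [conv_eq]
  exact (prod_summable ha hx H g).prod

lemma csum_conv {a x : G → ℂ} (ha : Summable fun u => ‖a u‖) (hx : Summable fun u => ‖x u‖)
    (H : Subgroup G) (g : G) : csum H (conv a x) g = ∑' u, a u * csum H x (u⁻¹ * g) := by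
  unfold csum
  simp_rw [conv_eq]
  rw [← (prod_summable ha hx H g).tsum_comm]
  simp_rw [tsum_mul_left, mul_assoc]

lemma bound_conv {ω : G → ℝ} (hω : IsWeight ω) {a x : G → ℂ} (ha : a ∈ l1w ω) (hx : x ∈ l1w ω)
    (H : Subgroup G) {ε : ℝ} (hε : ∀ g, ‖csum H x g‖ * wq ω H g ≤ ε) (g : G) :
    ‖csum H (conv a x) g‖ * wq ω H g ≤ (∑' u, ‖a u‖ * ω u) * ε := by
  have hw : 0 < wq ω H g := zero_lt_one.trans_le (one_le_wq hω H g)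
  rw [csum_conv (norm_summable hω ha) (norm_summable hω hx), ← le_div_iff₀ hw]
  have hs : HasSum (fun u => ‖a u‖ * ω u * (ε / wq ω H g))
      ((∑' u, ‖a u‖ * ω u) * (ε / wq ω H g)) := (Summable.hasSum ha).mul_right _
  rw [mul_div_assoc]
  refine tsum_of_norm_bounded hs fun u => ?_
  rw [norm_mul, mul_assoc]
  refine mul_le_mul_of_nonneg_left ?_ (norm_nonneg _)
  rw [← mul_div_assoc, le_div_iff₀ hw]
  have h1 : wq ω H g ≤ ω u * wq ω H (u⁻¹ * g) := by
    simpa using wq_mul hω H u (u⁻¹ * g)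
  have hu : 0 ≤ ω u := zero_le_one.trans (hω.1 u)
  calc _ ≤ ‖csum H x (u⁻¹ * g)‖ * (ω u * wq ω H (u⁻¹ * g)) :=
        mul_le_mul_of_nonneg_left h1 (norm_nonneg _)
    _ = ω u * (‖csum H x (u⁻¹ * g)‖ * wq ω H (u⁻¹ * g)) := by ring
    _ ≤ _ := mul_le_mul_of_nonneg_left (hε _) hu

lemma bound_tail {ω : G → ℝ} (hω : IsWeight ω) {x : G → ℂ} (hx : x ∈ l1w0 ω) {ε : ℝ}
    (hε : 0 < ε) : ∃ s : Finset G, ∀ H : Subgroup G, (s : Set G) ⊆ H →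
      ∀ g, ‖csum H x g‖ * wq ω H g ≤ ε := by
  obtain ⟨hx1, hx0⟩ := hx
  have hx1' : Summable fun u => ‖x u‖ * ω u := hx1
  have hn := norm_summable hω hx1
  have ht := tendsto_tsum_compl_atTop_zero fun u => ‖x u‖ * ω u
  obtain ⟨s, hs⟩ := (ht.eventually (gt_mem_nhds hε)).exists
  refine ⟨s, fun H hH g => ?_⟩
  have hnn : ∀ u, 0 ≤ ‖x u‖ * ω u := fun u =>
    mul_nonneg (norm_nonneg _) (zero_le_one.trans (hω.1 u))
  have hsub : Summable fun u : {u // u ∉ s} => ‖x u‖ * ω u := hx1'.subtype _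
  refine le_trans ?_ hs.le
  by_cases hg : g ∈ H
  · have h1 : csum H x g = ∑' h : H, x h := by
      unfold csum
      exact (Equiv.mulLeft (⟨g, hg⟩ : H)).tsum_eq (fun h : H => x h)
    have h2 : (∑' h : (H : Set G), x h) + ∑' h : ((H : Set G)ᶜ : Set G), x h = 0 := by
      rw [← hx0]
      exact (hn.of_norm.subtype _).tsum_add_tsum_compl (hn.of_norm.subtype _)
    have h3 : csum H x g = - ∑' h : ((H : Set G)ᶜ : Set G), x h := by
      rw [h1]; exact eq_neg_of_add_eq_zero_left h2
    have h4 : wq ω H g ≤ 1 := by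
      simpa [hω.2.1] using wq_le hω H g ⟨g⁻¹, H.inv_mem hg⟩
    refine (mul_le_of_le_one_right (norm_nonneg _) h4).trans ?_
    rw [h3, norm_neg]
    refine (norm_tsum_le_tsum_norm (hn.subtype _)).trans ?_
    refine Summable.tsum_le_tsum_of_inj
      (fun u : ((H : Set G)ᶜ : Set G) => (⟨u.1, fun hu => u.2 (hH hu)⟩ : {u // u ∉ s})) ?_
      (fun c _ => hnn c) ?_ (hn.subtype _) hsub
    · intro a b hab
      simpa [Subtype.ext_iff] using hab
    · intro u
      exact le_mul_of_one_le_right (norm_nonneg _) (hω.1 _)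
  · have hw : 0 ≤ wq ω H g := zero_le_one.trans (one_le_wq hω H g)
    have hc : Summable fun h : H => ‖x (g * h)‖ := hn.comp_injective (coset_inj H g)
    refine (mul_le_mul_of_nonneg_right (norm_tsum_le_tsum_norm hc) hw).trans ?_
    rw [← tsum_mul_right]
    refine Summable.tsum_le_tsum_of_inj
      (fun h : H => (⟨g * h, fun hu => hg ?_⟩ : {u // u ∉ s})) ?_
      (fun c _ => hnn c) ?_ (hc.mul_right _) hsub
    · have := hH hu
      exact (H.mul_mem_cancel_right h.2).1 this
    · intro a b hab
      exact coset_inj H g (congrArg Subtype.val hab)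
    · intro h
      exact mul_le_mul_of_nonneg_left (wq_le hω H g h) (norm_nonneg _)

/-- the test element -/
lemma exists_test {ω : G → ℝ} (hω : IsWeight ω) (g : ℕ → G) :
    ∃ f ∈ l1w0 ω, ∀ (k : ℕ) (H : Subgroup G), g k ∉ H →
      (1 / 2 : ℝ) ^ k / ω (g k) ≤ ‖csum H f (g k)‖ := by
  classical
  set b : ℕ → ℝ := fun k => (1 / 2 : ℝ) ^ k / ω (g k) with hb
  have hpos : ∀ u, 0 < ω u := fun u => zero_lt_one.trans_le (hω.1 u)
  have hb0 : ∀ k, 0 ≤ b k := fun k => div_nonneg (by positivity) (hpos _).le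
  have hbw : Summable fun k => b k * ω (g k) := by
    have : (fun k => b k * ω (g k)) = fun k => (1 / 2 : ℝ) ^ k := by
      funext k; simp only [hb]; exact div_mul_cancel₀ _ (hpos _).ne'
    rw [this]; exact summable_geometric_two
  have hbs : Summable b := Summable.of_nonneg_of_le hb0
    (fun k => le_mul_of_one_le_right (hb0 k) (hω.1 _)) hbw
  set D : G → ℝ := fun u => ∑' k : (g ⁻¹' {u}), b k with hD
  have hD0 : ∀ u, 0 ≤ D u := fun u => tsum_nonneg fun k => hb0 _
  have hDs : HasSum D (∑' k, b k) := hbs.hasSum.tsum_fiberwise g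
  have hDw : Summable fun u => D u * ω u := by
    have h1 := (hbw.hasSum.tsum_fiberwise g).summable
    refine h1.congr fun u => ?_
    simp only [hD]
    rw [← tsum_mul_right]
    refine tsum_congr fun k => ?_
    rw [show g k = u from k.2]
  have hDg : ∀ k, b k ≤ D (g k) := fun k =>
    (hbs.subtype (g ⁻¹' {g k})).le_tsum (⟨k, rfl⟩ : (g ⁻¹' {g k})) (fun j _ => hb0 _)
  set B := ∑' k, b k
  have hδ : HasSum (fun u : G => if u = 1 then B else 0) B := hasSum_ite_eq 1 B
  refine ⟨fun u => ((D u - if u = 1 then B else 0 : ℝ) : ℂ), ⟨?_, ?_⟩, ?_⟩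
  · have h2 : Summable fun u => D u * ω u + (if u = 1 then B else 0) := hDw.add hδ.summable
    have hB : 0 ≤ B := tsum_nonneg hb0
    refine Summable.of_nonneg_of_le (fun u => mul_nonneg (norm_nonneg _) (hpos u).le)
      (fun u => ?_) h2
    rw [Complex.norm_real, Real.norm_eq_abs]
    have h3 : |D u - if u = 1 then B else 0| ≤ D u + if u = 1 then B else 0 := by
      refine (abs_sub _ _).trans ?_
      rw [abs_of_nonneg (hD0 u), abs_of_nonneg (by split_ifs <;> simp [hB])]
    refine (mul_le_mul_of_nonneg_right h3 (hpos u).le).trans ?_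
    rw [add_mul]
    split_ifs with h
    · rw [h, hω.2.1]; simp
    · simp
  · have := (Complex.hasSum_ofReal.2 (hDs.sub hδ)).tsum_eq
    simpa using this
  · intro k H hk
    have h1 : csum H (fun u => ((D u - if u = 1 then B else 0 : ℝ) : ℂ)) (g k)
        = ((∑' h : H, D (g k * h) : ℝ) : ℂ) := by
      unfold csum
      rw [Complex.ofReal_tsum]
      refine tsum_congr fun h => ?_
      have : g k * h ≠ 1 := fun h1 => hk (by
        rw [eq_inv_of_mul_eq_one_left h1]; exact H.inv_mem h.2)
      simp [this]
    have h2 : D (g k) ≤ ∑' h : H, D (g k * h) := by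
      have := (hDs.summable.comp_injective (coset_inj H (g k))).le_tsum (1 : H)
        (fun j _ => hD0 _)
      simpa using this
    rw [h1, Complex.norm_real, Real.norm_eq_abs]
    exact ((hDg k).trans h2).trans (le_abs_self _)

lemma main_aux (ω : G → ℝ) (hω : IsWeight ω)
    (h : IsFinGenLeftIdealOf ω (l1w0 ω)) : Group.FG G := by
  classical
  by_contra hG
  obtain ⟨n, x, hx, hI⟩ := h
  have hpos : ∀ u, 0 < ω u := fun u => zero_lt_one.trans_le (hω.1 u)
  have hx0 : ∀ i, x i ∈ l1w0 ω := by
    intro i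
    rw [hI]
    refine ⟨fun _ => 0, Pi.single i 1, fun j => ?_, ?_⟩
    · simp [l1w, summable_zero]
    · have h0 : ∀ y : G → ℂ, conv 0 y = 0 := by
        intro y; funext u; simp [conv]
      have : ∀ j, conv (0 : G → ℂ) (x j) + (Pi.single i 1 : Fin n → ℂ) j • x j
          = if j = i then x i else 0 := by
        intro j
        by_cases hj : j = i
        · subst hj; simp [h0]
        · simp [h0, hj]
      simp only [this]
      simp
  have hstep : ∀ k : ℕ, ∃ (H : Subgroup G) (g : G), g ∉ H ∧ ω g ≤ 2 * wq ω H g ∧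
      ∀ i v, ‖csum H (x i) v‖ * wq ω H v ≤ (1 / 4 : ℝ) ^ k := by
    intro k
    have hk : (0 : ℝ) < (1 / 4) ^ k := by positivity
    choose s hs using fun i => bound_tail hω (hx0 i) hk
    let F : Finset G := Finset.univ.biUnion s
    let H := Subgroup.closure (F : Set G)
    have hH : H ≠ ⊤ := fun hH => hG (Group.fg_iff.2 ⟨F, hH, F.finite_toSet⟩)
    obtain ⟨g, hg⟩ : ∃ g, g ∉ H := by
      by_contra! hc
      exact hH ((Subgroup.eq_top_iff' H).2 hc)
    have h1 : wq ω H g < 2 * wq ω H g := by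
      linarith [one_le_wq hω H g]
    obtain ⟨h, hh⟩ := exists_lt_of_ciInf_lt h1
    have hq : wq ω H (g * h) = wq ω H g := by
      unfold wq
      simp_rw [mul_assoc]
      exact (Equiv.mulLeft h).iInf_congr fun y => rfl
    refine ⟨H, g * h, fun hc => hg ((H.mul_mem_cancel_right h.2).1 hc), ?_, ?_⟩
    · rw [hq]; exact hh.le
    · intro i
      refine hs i H ?_
      refine Set.Subset.trans ?_ Subgroup.subset_closure
      exact_mod_cast Finset.subset_biUnion_of_mem s (Finset.mem_univ i)
  choose H g hg hgw hb using hstep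
  obtain ⟨f, hf, hfl⟩ := exists_test hω g
  rw [hI] at hf
  obtain ⟨a, c, ha, hfe⟩ := hf
  set C : ℝ := ∑ i, ((∑' u, ‖a i u‖ * ω u) + ‖c i‖) with hC
  have key : ∀ k : ℕ, (1 / 2 : ℝ) ^ k / 2 ≤ C * (1 / 4 : ℝ) ^ k := by
    intro k
    have hw : 0 < wq ω (H k) (g k) := zero_lt_one.trans_le (one_le_wq hω _ _)
    have e1 : csum (H k) f (g k)
        = ∑ i, (csum (H k) (conv (a i) (x i)) (g k) + c i * csum (H k) (x i) (g k)) := by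
      have hs1 : ∀ i, Summable fun h : H k => conv (a i) (x i) (g k * h) := fun i =>
        conv_summable (norm_summable hω (ha i)) (norm_summable hω (hx i)) _ _
      have hs2 : ∀ i, Summable fun h : H k => x i (g k * h) := fun i =>
        (norm_summable hω (hx i)).of_norm.comp_injective (coset_inj (H k) (g k))
      have := hasSum_sum (s := Finset.univ) fun i _ =>
        (hs1 i).hasSum.add ((hs2 i).hasSum.mul_left (c i))
      unfold csum
      rw [← this.tsum_eq, hfe]
      refine tsum_congr fun h => ?_
      simp [Finset.sum_apply]
    have e2 : ‖csum (H k) f (g k)‖ * wq ω (H k) (g k) ≤ C * (1 / 4 : ℝ) ^ k := by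
      rw [e1, hC, Finset.sum_mul]
      refine (mul_le_mul_of_nonneg_right (norm_sum_le _ _) hw.le).trans ?_
      rw [Finset.sum_mul]
      refine Finset.sum_le_sum fun i _ => ?_
      refine (mul_le_mul_of_nonneg_right (norm_add_le _ _) hw.le).trans ?_
      rw [add_mul, add_mul, norm_mul, mul_assoc]
      exact add_le_add (bound_conv hω (ha i) (hx i) (H k) (hb k i) (g k))
        (mul_le_mul_of_nonneg_left (hb k i _) (norm_nonneg _))
    refine le_trans ?_ e2
    refine le_trans ?_ (mul_le_mul_of_nonneg_right (hfl k (H k) (hg k)) hw.le)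
    rw [div_mul_eq_mul_div, le_div_iff₀ (hpos _), div_mul_eq_mul_div, mul_div_assoc]
    refine mul_le_mul_of_nonneg_left ?_ (by positivity)
    linarith [hgw k]
  obtain ⟨k, hk⟩ := pow_unbounded_of_one_lt (2 * C) (one_lt_two : (1 : ℝ) < 2)
  have h1 := key k
  have h2 : (1 / 4 : ℝ) ^ k = (1 / 2) ^ k * (1 / 2) ^ k := by
    rw [← mul_pow]; norm_num
  have h3 : (0 : ℝ) < (1 / 2) ^ k := by positivity
  have h4 : (2 : ℝ) ^ k * (1 / 2) ^ k = 1 := by rw [← mul_pow]; norm_num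
  rw [h2] at h1
  have h5 : 2 * C * (1 / 2) ^ k < 1 := by
    refine lt_of_lt_of_eq ?_ h4; exact mul_lt_mul_of_pos_right hk h3
  nlinarith

end helpers

/-- Lemma 3.5a: if `G` is a (discrete) group, `ω` a weight on `G`, and the augmentation
ideal `ℓ¹₀(G, ω)` is finitely generated as a left ideal of `ℓ¹(G, ω)`, then `G` is
finitely generated as a group. -/
theorem stmt8 {G : Type*} [Group G] (ω : G → ℝ) (hω : IsWeight ω)
    (h : IsFinGenLeftIdealOf ω (l1w0 ω)) : Group.FG G := by
  exact main_aux ω hω h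
end
end

section
/- Let ω be a weight on ℤ. Then the augmentation ideal ℓ¹₀(ℤ, ω) is finitely-generated as an ideal of ℓ¹(ℤ, ω) if and only if both sequences (ωₙ)_{n∈ℕ} and (ω₋ₙ)_{n∈ℕ} are tail-preserving. -/
noncomputable section

open scoped BigOperators

/-- Convolution of two functions on a (discrete) additive group:
`(f ∗ g)(n) = ∑_{s+t = n} f(s) g(t)`. -/
def aconv {M : Type*} [Add M] (f g : M → ℂ) : M → ℂ :=
  fun n => ∑' p : {p : M × M // p.1 + p.2 = n}, f (p : M × M).1 * g (p : M × M).2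

/-- The weighted space `ℓ¹(ℤ, ω)`, as a set of functions `ℤ → ℂ`. -/
def l1wZ (ω : ℤ → ℝ) : Set (ℤ → ℂ) := {f | Summable fun n => ‖f n‖ * ω n}

/-- The augmentation ideal `ℓ¹₀(ℤ, ω) = {f ∈ ℓ¹(ℤ, ω) : ∑_n f(n) = 0}`. -/
def l1w0Z (ω : ℤ → ℝ) : Set (ℤ → ℂ) := {f ∈ l1wZ ω | ∑' n, f n = 0}

/-- A weight on the additive group `ℤ`: a function `ω : ℤ → [1,∞)` with `ω 0 = 1`
which is submultiplicative. -/
def IsWeightInt (ω : ℤ → ℝ) : Prop :=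
  (∀ n, 1 ≤ ω n) ∧ ω 0 = 1 ∧ ∀ m n, ω (m + n) ≤ ω m * ω n

/-- `I` is finitely generated as a (left) ideal of `ℓ¹(ℤ, ω)`:
`I = A♯x₁ + ⋯ + A♯xₙ` for some `x₁, …, xₙ ∈ A = ℓ¹(ℤ, ω)`, where `A♯` is the
(conditional) unitisation, so `A♯x = {a ∗ x + c x : a ∈ A, c ∈ ℂ}`;
no closure is taken. -/
def IsFinGenIdealOfZ (ω : ℤ → ℝ) (I : Set (ℤ → ℂ)) : Prop :=
  ∃ (n : ℕ) (x : Fin n → (ℤ → ℂ)), (∀ i, x i ∈ l1wZ ω) ∧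
    I = {f | ∃ (a : Fin n → (ℤ → ℂ)) (c : Fin n → ℂ), (∀ i, a i ∈ l1wZ ω) ∧
          f = ∑ i, (aconv (a i) (x i) + c i • x i)}

/-- The tail `∑_{j=n+1}^∞ x_j` of a sequence, in 0-indexed form. -/
def tailFrom (x : ℕ → ℂ) (n : ℕ) : ℂ := ∑' j : ℕ, x (n + 1 + j)

/-- A sequence `τ` in `[1,∞)` is tail-preserving if for every complex sequence `x` with
`∑ τₙ|xₙ| < ∞` one has `∑ τₙ|∑_{j>n} x_j| < ∞`.  (0-indexed: `τ n` is the paper's `τ_{n+1}`.) -/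
def TailPreserving (τ : ℕ → ℝ) : Prop :=
  ∀ x : ℕ → ℂ, Summable (fun n => τ n * ‖x n‖) →
    Summable (fun n => τ n * ‖tailFrom x n‖)

section helpers

open Filter Topology

lemma l1w_summable {ω : ℤ → ℝ} (hω : IsWeightInt ω) {f : ℤ → ℂ} (hf : f ∈ l1wZ ω) :
    Summable f := by
  apply Summable.of_norm
  refine Summable.of_nonneg_of_le (fun n => norm_nonneg _) (fun n => ?_) hf
  exact le_mul_of_one_le_right (norm_nonneg _) (hω.1 n)

lemma aconv_eq (a x : ℤ → ℂ) (n : ℤ) : aconv a x n = ∑' k : ℤ, a (n - k) * x k := by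
  unfold aconv
  let e : ℤ ≃ {p : ℤ × ℤ // p.1 + p.2 = n} :=
    { toFun := fun k => ⟨(n - k, k), by simp⟩
      invFun := fun p => p.1.2
      left_inv := fun k => rfl
      right_inv := by
        rintro ⟨⟨p, q⟩, h⟩
        simp only at h
        ext <;> simp
        omega }
  rw [← e.tsum_eq]
  rfl

/-- membership of shifts -/
lemma l1w_shift {ω : ℤ → ℝ} (hω : IsWeightInt ω) {f : ℤ → ℂ} (hf : f ∈ l1wZ ω) (k : ℤ) :
    (fun n => f (n - k)) ∈ l1wZ ω := by
  have h1 : Summable fun n => ω k * (‖f (n - k)‖ * ω (n - k)) :=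
    (((Equiv.subRight k).summable_iff (f := fun n => ‖f n‖ * ω n)).2 hf).mul_left _
  refine Summable.of_nonneg_of_le (fun n => ?_) (fun n => ?_) h1
  · exact mul_nonneg (norm_nonneg _) (zero_le_one.trans (hω.1 n))
  · have := hω.2.2 k (n - k)
    rw [show k + (n - k) = n by ring] at this
    calc _ ≤ ‖f (n - k)‖ * (ω k * ω (n - k)) := by gcongr
      _ = _ := by ring

lemma l1w_add {ω : ℤ → ℝ} (hω : IsWeightInt ω) {f g : ℤ → ℂ} (hf : f ∈ l1wZ ω)
    (hg : g ∈ l1wZ ω) : f + g ∈ l1wZ ω := by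
  refine Summable.of_nonneg_of_le (fun n => ?_) (fun n => ?_) (Summable.add hf hg)
  · exact mul_nonneg (norm_nonneg _) (zero_le_one.trans (hω.1 n))
  · rw [← add_mul]
    exact mul_le_mul_of_nonneg_right (norm_add_le _ _) (zero_le_one.trans (hω.1 n))

lemma l1w_smul {ω : ℤ → ℝ} {f : ℤ → ℂ} (c : ℂ) (hf : f ∈ l1wZ ω) : c • f ∈ l1wZ ω := by
  have := Summable.mul_left ‖c‖ hf
  refine this.congr (fun n => ?_)
  simp [mul_assoc]

lemma l1w_finite {ω : ℤ → ℝ} {f : ℤ → ℂ} (hf : f.support.Finite) : f ∈ l1wZ ω := by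
  refine summable_of_hasFiniteSupport (hf.subset ?_)
  intro n hn h
  exact hn (by simp [h])

/-- The property of being a difference of an element of `l1wZ ω` and its shift. -/
def IsDiff (ω : ℤ → ℝ) (f : ℤ → ℂ) : Prop := ∃ g ∈ l1wZ ω, ∀ n, f n = g (n - 1) - g n

lemma IsDiff.add {ω : ℤ → ℝ} (hω : IsWeightInt ω) {f g : ℤ → ℂ} (hf : IsDiff ω f)
    (hg : IsDiff ω g) : IsDiff ω (f + g) := by
  obtain ⟨u, hu, h⟩ := hf
  obtain ⟨v, hv, h'⟩ := hg
  refine ⟨u + v, l1w_add hω hu hv, fun n => ?_⟩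
  simp only [Pi.add_apply, h, h']
  ring

lemma IsDiff.smul {ω : ℤ → ℝ} {f : ℤ → ℂ} (c : ℂ) (hf : IsDiff ω f) : IsDiff ω (c • f) := by
  obtain ⟨u, hu, h⟩ := hf
  refine ⟨c • u, l1w_smul c hu, fun n => ?_⟩
  simp only [Pi.smul_apply, h, smul_eq_mul]
  ring

lemma IsDiff.zero {ω : ℤ → ℝ} : IsDiff ω 0 :=
  ⟨0, l1w_finite (by simp), by simp⟩

lemma IsDiff.sum {ω : ℤ → ℝ} (hω : IsWeightInt ω) {ι : Type*} (s : Finset ι) (f : ι → ℤ → ℂ)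
    (h : ∀ i ∈ s, IsDiff ω (f i)) : IsDiff ω (∑ i ∈ s, f i) := by
  induction s using Finset.cons_induction with
  | empty => simpa using IsDiff.zero
  | cons i s hi ih =>
    rw [Finset.sum_cons]
    exact (h i (by simp)).add hω (ih fun j hj => h j (by simp [hj]))

lemma IsDiff.shift {ω : ℤ → ℝ} (hω : IsWeightInt ω) {f : ℤ → ℂ} (hf : f ∈ l1wZ ω) (k : ℤ) :
    IsDiff ω (fun n => f (n - k) - f n) := by
  induction k using Int.induction_on with
  | zero => simpa using! (IsDiff.zero (ω := ω))
  | succ k ih =>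
    have h : IsDiff ω (fun n => f (n - (k + 1)) - f (n - k)) := by
      refine ⟨_, l1w_shift hω hf k, fun n => ?_⟩
      simp only
      congr 2
      ring
    convert! ih.add hω h using 1
    ext n
    simp
  | pred k ih =>
    have h : IsDiff ω (fun n => f (n - (-k - 1)) - f (n - (-k))) := by
      refine ⟨_, l1w_smul (-1) (l1w_shift hω hf (-k - 1)), fun n => ?_⟩
      simp only [Pi.smul_apply, smul_eq_mul]
      rw [show n - 1 - (-(k:ℤ) - 1) = n - -k by ring]
      ring
    convert! ih.add hω h using 1
    ext n
    simp

lemma IsDiff.mem {ω : ℤ → ℝ} (hω : IsWeightInt ω) {f : ℤ → ℂ} (hf : IsDiff ω f) :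
    f ∈ l1w0Z ω := by
  obtain ⟨g, hg, h⟩ := hf
  have h1 := l1w_shift hω hg 1
  have : f = (fun n => g (n - 1)) + (-1 : ℂ) • g := by
    ext n
    simp [h n, sub_eq_add_neg]
  refine ⟨this ▸ l1w_add hω h1 (l1w_smul _ hg), ?_⟩
  have e : ∑' n, f n = ∑' n, (g (n - 1) - g n) := tsum_congr h
  rw [e, (l1w_summable hω h1).tsum_sub (l1w_summable hω hg)]
  have := (Equiv.subRight (1 : ℤ)).tsum_eq g
  simp only [Equiv.subRight_apply] at this
  rw [this, sub_self]

lemma inj_add (n : ℤ) : Function.Injective (fun j : ℕ => n + j) := fun a b h => by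
  simpa using h

lemma summable_int_iff' {E : Type*} [NormedAddCommGroup E] [CompleteSpace E] {f : ℤ → E} :
    Summable f ↔ (Summable fun n : ℕ => f n) ∧ (Summable fun n : ℕ => f (-((n : ℤ) + 1))) := by
  refine ⟨fun p => ⟨p.comp_injective Nat.cast_injective, ?_⟩,
    fun h => Summable.of_nat_of_neg_add_one h.1 h.2⟩
  exact p.comp_injective (i := fun n : ℕ => -((n : ℤ) + 1)) (fun a b h => by simpa using h)

lemma inj_sub (n : ℤ) : Function.Injective (fun j : ℕ => n - j) := fun a b h => by
  simpa using h

lemma tail_step {f : ℤ → ℂ} (hf : Summable f) (n : ℤ) :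
    ∑' j : ℕ, f (n + j) = f n + ∑' j : ℕ, f (n + 1 + j) := by
  have h := (hf.comp_injective (inj_add n)).tsum_eq_zero_add
  simp only [Function.comp_def] at h
  rw [h]
  simp [add_comm, add_left_comm]

lemma tail_step' {f : ℤ → ℂ} (hf : Summable f) (n : ℤ) :
    ∑' j : ℕ, f (n - j) = f n + ∑' j : ℕ, f (n - 1 - j) := by
  have h := (hf.comp_injective (inj_sub n)).tsum_eq_zero_add
  simp only [Function.comp_def] at h
  rw [h]
  simp [sub_sub, add_comm]

lemma diff_tail {f g : ℤ → ℂ} (hg : Summable g) (h : ∀ n, f n = g (n - 1) - g n) (n : ℤ) :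
    ∑' j : ℕ, f (n + 1 + j) = g n := by
  have e : ∀ j : ℕ, f (n + 1 + j) = g (n + j) - g (n + 1 + j) := fun j => by
    rw [h, show n + 1 + (j:ℤ) - 1 = n + j by ring]
  rw [tsum_congr e, Summable.tsum_sub (f := fun j : ℕ => g (n + j)) (g := fun j : ℕ => g (n + 1 + j))
    (hg.comp_injective (inj_add n)) (hg.comp_injective (inj_add (n + 1))), tail_step hg]
  ring

lemma diff_tail' {f g : ℤ → ℂ} (hg : Summable g) (h : ∀ n, f n = g (n - 1) - g n) (n : ℤ) :
    ∑' j : ℕ, f (n - j) = - g n := by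
  have e : ∀ j : ℕ, f (n - j) = g (n - 1 - j) - g (n - j) := fun j => by
    rw [h, show n - (j:ℤ) - 1 = n - 1 - j by ring]
  rw [tsum_congr e, Summable.tsum_sub (f := fun j : ℕ => g (n - 1 - j)) (g := fun j : ℕ => g (n - j))
    (hg.comp_injective (inj_sub (n - 1))) (hg.comp_injective (inj_sub n)), tail_step' hg n]
  ring

/-- Tail-preservation is equivalent to every element being a difference: first direction. -/
lemma isDiff_of_tail {ω : ℤ → ℝ} (hω : IsWeightInt ω)
    (h1 : TailPreserving (fun n : ℕ => ω ((n : ℤ) + 1)))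
    (h2 : TailPreserving (fun n : ℕ => ω (-((n : ℤ) + 1)))) {f : ℤ → ℂ} (hf : f ∈ l1w0Z ω) :
    IsDiff ω f := by
  obtain ⟨hf, h0⟩ := hf
  have hs := l1w_summable hω hf
  have hpos : ∀ n, 0 ≤ ω n := fun n => zero_le_one.trans (hω.1 n)
  refine ⟨fun n => if 0 ≤ n then ∑' j : ℕ, f (n + 1 + j) else - ∑' j : ℕ, f (n - j), ?_, ?_⟩
  · rw [l1wZ, Set.mem_ofPred_eq, summable_int_iff']
    constructor
    · rw [← summable_nat_add_iff 1]
      have := h1 (fun n => f ((n : ℤ) + 1)) (by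
        have := Summable.comp_injective hf (inj_add 1)
        refine this.congr fun n => ?_
        simp only [Function.comp_def]
        rw [mul_comm, add_comm])
      refine this.congr fun n => ?_
      beta_reduce
      rw [if_pos (by positivity), mul_comm, tailFrom]
      push_cast
      congr 3
      ext j
      congr 1
      ring
    · rw [← summable_nat_add_iff 1]
      have := h2 (fun n => f (-((n : ℤ) + 1))) (by
        have := Summable.comp_injective hf (inj_sub (-1))
        refine this.congr fun n => ?_
        simp only [Function.comp_def]
        rw [mul_comm, show (-1 - n : ℤ) = -(n + 1) by ring])
      refine Summable.of_nonneg_of_le (fun n => ?_) (fun n => ?_) (this.mul_left (ω (-1)))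
      · exact mul_nonneg (norm_nonneg _) (hpos _)
      · beta_reduce
        rw [if_neg (by push_cast; omega), norm_neg, tailFrom]
        have hw := hω.2.2 (-1) (-((n : ℤ) + 1))
        push_cast
        rw [show (-1 + -((n : ℤ) + 1)) = -(n + 1 + 1) by ring] at hw
        have e : ∑' j : ℕ, f (-((n:ℤ) + 1 + 1) - j) = ∑' j : ℕ, f (-((n:ℤ) + 1 + j + 1)) := by
          congr 1
          ext j
          congr 1
          ring
        rw [e]
        calc _ ≤ ‖∑' j : ℕ, f (-((n:ℤ) + 1 + j + 1))‖ * (ω (-1) * ω (-((n : ℤ) + 1))) := by gcongr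
          _ = _ := by ring
  · intro n
    rcases lt_trichotomy n 0 with hn | hn | hn
    · simp only [if_neg (show ¬ (0 ≤ n) by omega), if_neg (show ¬ (0 ≤ n - 1) by omega)]
      rw [tail_step' hs n]
      ring
    · subst hn
      have := hs
      rw [summable_int_iff'] at this
      rw [tsum_of_nat_of_neg_add_one this.1 this.2] at h0
      have a := tail_step hs 0
      simp only [zero_add] at a
      rw [a] at h0
      have e : ∑' j : ℕ, f (-1 - j) = ∑' j : ℕ, f (-((j:ℤ) + 1)) := by
        congr 1
        ext j
        congr 1
        ring
      simp
      rw [e]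
      linear_combination h0
    · simp only [if_pos (show (0 ≤ n) by omega), if_pos (show (0 ≤ n - 1) by omega)]
      rw [show n - 1 + 1 = n by ring, tail_step hs n]
      ring

lemma ofNat_support0 {x : ℕ → ℂ} (e : ℕ → ℤ) (he : Function.Injective e) {ω : ℤ → ℝ}
    (hx : Summable fun n => ω (e n) * ‖x n‖) :
    ∃ F ∈ l1wZ ω, ∀ n, F (e n) = x n := by
  refine ⟨Function.extend e x 0, ?_, fun n => he.extend_apply _ _ _⟩
  have : (fun n => ‖Function.extend e x 0 n‖ * ω n) =
      Function.extend e (fun n => ω (e n) * ‖x n‖) 0 := by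
    ext n
    by_cases h : ∃ m, e m = n
    · obtain ⟨m, rfl⟩ := h
      rw [he.extend_apply, he.extend_apply, mul_comm]
    · rw [Function.extend_apply' _ _ _ h, Function.extend_apply' _ _ _ h]
      simp
  rw [l1wZ, Set.mem_ofPred_eq, this, summable_extend_zero he]
  exact hx

lemma single_mem (ω : ℤ → ℝ) (k : ℤ) (c : ℂ) : (Pi.single k c : ℤ → ℂ) ∈ l1wZ ω :=
  l1w_finite ((Set.finite_singleton k).subset Pi.support_single_subset)

lemma sub_single_mem {ω : ℤ → ℝ} (hω : IsWeightInt ω) {F : ℤ → ℂ} (hF : F ∈ l1wZ ω) :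
    F + Pi.single 0 (-∑' n, F n) ∈ l1w0Z ω := by
  generalize hS : ∑' n, F n = S
  refine ⟨l1w_add hω hF (single_mem _ _ _), ?_⟩
  have := (l1w_summable hω hF).tsum_add (l1w_summable hω (single_mem ω 0 (-S)))
  simp only [Pi.add_apply]
  rw [this, tsum_pi_single, hS]
  ring

lemma ofNat_support {x : ℕ → ℂ} (e : ℕ → ℤ) (he : Function.Injective e) {ω : ℤ → ℝ}
    (hω : IsWeightInt ω) (he0 : ∀ n, e n ≠ 0)
    (hx : Summable fun n => ω (e n) * ‖x n‖) :
    ∃ f ∈ l1w0Z ω, ∀ n, f (e n) = x n := by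
  obtain ⟨F, hF, hFe⟩ := ofNat_support0 e he hx
  refine ⟨_, sub_single_mem hω hF, fun n => ?_⟩
  rw [Pi.add_apply, hFe, Pi.single_eq_of_ne (he0 n), add_zero]

lemma tail_of_isDiff {ω : ℤ → ℝ} (hω : IsWeightInt ω) (h : ∀ f ∈ l1w0Z ω, IsDiff ω f) :
    TailPreserving (fun n : ℕ => ω ((n : ℤ) + 1)) ∧
    TailPreserving (fun n : ℕ => ω (-((n : ℤ) + 1))) := by
  constructor
  · intro x hx
    obtain ⟨f, hf, hfx⟩ := ofNat_support (fun n : ℕ => (n:ℤ) + 1)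
      (fun a b h => by simpa using h) hω (fun n => by positivity) hx
    obtain ⟨g, hg, hfg⟩ := h f hf
    refine (Summable.comp_injective hg (inj_add 1)).congr fun n => ?_
    simp only [Function.comp_def]
    rw [mul_comm, ← diff_tail (l1w_summable hω hg) hfg, tailFrom, add_comm 1 (n:ℤ)]
    congr 3
    ext j
    rw [← hfx]
    congr 1
    push_cast
    ring
  · intro x hx
    obtain ⟨f, hf, hfx⟩ := ofNat_support (fun n : ℕ => -((n:ℤ) + 1))
      (fun a b h => by simpa using h) hω (fun n => by omega) hx
    obtain ⟨g, hg, hfg⟩ := h f hf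
    refine Summable.of_nonneg_of_le (fun n => ?_) (fun n => ?_)
      ((Summable.comp_injective hg (inj_sub (-2))).mul_left (ω 1))
    · exact mul_nonneg (zero_le_one.trans (hω.1 _)) (norm_nonneg _)
    · simp only [Function.comp_def]
      have hw := hω.2.2 1 (-2 - (n:ℤ))
      rw [show 1 + (-2 - (n:ℤ)) = -(n+1) by ring] at hw
      have e : ‖tailFrom x n‖ = ‖g (-2 - n)‖ := by
        rw [← norm_neg (g _), ← diff_tail' (l1w_summable hω hg) hfg, tailFrom]
        congr 2
        ext j
        rw [← hfx]
        congr 1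
        push_cast
        ring
      rw [e]
      calc _ ≤ (ω 1 * ω (-2 - n)) * ‖g (-2 - n)‖ := by gcongr
        _ = _ := by ring

lemma finGen_of_isDiff {ω : ℤ → ℝ} (hω : IsWeightInt ω) (h : ∀ f ∈ l1w0Z ω, IsDiff ω f) :
    IsFinGenIdealOfZ ω (l1w0Z ω) := by
  let x : ℤ → ℂ := Pi.single 1 1 - Pi.single 0 1
  have hx : ∀ a : ℤ → ℂ, ∀ n, aconv a x n = a (n - 1) - a n := by
    intro a n
    rw [aconv_eq, tsum_eq_sum (s := {0, 1})]
    · simp [x]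
      ring
    · intro b hb
      simp at hb
      simp [x, hb]
  have hxd : IsDiff ω x := by
    refine ⟨Pi.single 0 1, l1w_finite ((Set.finite_singleton 0).subset Pi.support_single_subset),
      fun n => ?_⟩
    simp [x, Pi.single_apply, sub_eq_zero]
  refine ⟨1, fun _ => x, fun _ => (hxd.mem hω).1, ?_⟩
  ext f
  constructor
  · intro hf
    obtain ⟨g, hg, hfg⟩ := h f hf
    refine ⟨fun _ => g, 0, fun _ => hg, ?_⟩
    ext n
    simp [hx, hfg]
  · rintro ⟨a, c, ha, rfl⟩
    apply IsDiff.mem hω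
    apply IsDiff.sum hω
    intro i _
    exact IsDiff.add hω ⟨a i, ha i, hx _⟩ (hxd.smul _)

lemma surj_of_close {E F : Type*} [NormedAddCommGroup E] [NormedSpace ℂ E] [CompleteSpace E]
    [NormedAddCommGroup F] [NormedSpace ℂ F] [CompleteSpace F] (T : E →L[ℂ] F)
    (hT : Function.Surjective T) : ∀ᶠ S : E →L[ℂ] F in 𝓝 T, Function.Surjective S := by
  have hr : T.range = ⊤ := LinearMap.range_eq_top.2 hT
  let N := T.nonlinearRightInverseOfSurjective hr
  have hN : 0 < N.nnnorm := T.nonlinearRightInverseOfSurjective_nnnorm_pos hr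
  have hN' : (0:ℝ) < (N.nnnorm : ℝ)⁻¹ := by positivity
  filter_upwards [Metric.ball_mem_nhds T hN'] with S hS y
  rw [Metric.mem_ball, dist_eq_norm] at hS
  have hap : ApproximatesLinearOn S T Set.univ ‖S - T‖₊ := by
    intro u _ v _
    rw [← map_sub, ← ContinuousLinearMap.sub_apply]
    exact (S - T).le_opNorm _
  have hd : 0 < (N.nnnorm : ℝ)⁻¹ - ‖S - T‖₊ := by simpa using hS
  have := hap.surjOn_closedBall_of_nonlinearRightInverse N
    (ε := ‖y‖ / ((N.nnnorm : ℝ)⁻¹ - ‖S - T‖₊)) (b := 0) (by positivity) (Set.subset_univ _)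
  rw [mul_div_cancel₀ _ hd.ne', map_zero] at this
  obtain ⟨u, _, hu⟩ := this (show y ∈ _ by simp)
  exact ⟨u, hu⟩

/-- The model Banach space. -/
abbrev EE := lp (fun _ : ℤ => ℂ) 1

lemma EE_summable (u : EE) : Summable fun n => ‖u n‖ := by
  simpa using (lp.memℓp u).summable (by simp)

lemma EE_norm (u : EE) : ‖u‖ = ∑' n, ‖u n‖ := by
  simpa using lp.norm_eq_tsum_rpow (by simp) u

/-- embed -/
def toEE (ω : ℤ → ℝ) (hω : IsWeightInt ω) (f : ℤ → ℂ) (hf : f ∈ l1wZ ω) : EE :=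
  ⟨fun n => f n * ω n, memℓp_gen (by
    have hpos : ∀ n, 0 ≤ ω n := fun n => zero_le_one.trans (hω.1 n)
    refine Summable.congr hf fun n => ?_
    simp [abs_of_nonneg (hpos n)])⟩

/-- unembed -/
def ofEE (ω : ℤ → ℝ) (u : EE) : ℤ → ℂ := fun n => u n / ω n

lemma toEE_apply {ω : ℤ → ℝ} (hω : IsWeightInt ω) {f : ℤ → ℂ} (hf : f ∈ l1wZ ω) (n : ℤ) :
    toEE ω hω f hf n = f n * ω n := rfl

lemma ofEE_mem {ω : ℤ → ℝ} (hω : IsWeightInt ω) (u : EE) : ofEE ω u ∈ l1wZ ω := by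
  refine (EE_summable u).congr fun n => ?_
  have hpos : 0 < ω n := zero_lt_one.trans_le (hω.1 n)
  simp [ofEE, abs_of_pos hpos, hpos.ne']

lemma ofEE_toEE {ω : ℤ → ℝ} (hω : IsWeightInt ω) {f : ℤ → ℂ} (hf : f ∈ l1wZ ω) :
    ofEE ω (toEE ω hω f hf) = f := by
  ext n
  have hpos : 0 < ω n := zero_lt_one.trans_le (hω.1 n)
  have : (ω n : ℂ) ≠ 0 := by exact_mod_cast hpos.ne'
  simp [ofEE, toEE_apply, this]

lemma ofEE_inj {ω : ℤ → ℝ} (hω : IsWeightInt ω) {u v : EE} (h : ofEE ω u = ofEE ω v) : u = v := by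
  ext n
  have hpos : 0 < ω n := zero_lt_one.trans_le (hω.1 n)
  have h0 : (ω n : ℂ) ≠ 0 := by exact_mod_cast hpos.ne'
  have := congrFun h n
  simp only [ofEE] at this
  field_simp at this
  exact this

/-- coordinate evaluation as a linear map into functions. -/
def ofEEL (ω : ℤ → ℝ) : EE →ₗ[ℂ] (ℤ → ℂ) where
  toFun := ofEE ω
  map_add' u v := by ext n; simp [ofEE, add_div]
  map_smul' c u := by ext n; simp [ofEE, mul_div_assoc]

lemma shift_bound {ω : ℤ → ℝ} (hω : IsWeightInt ω) (k : ℤ) (u : EE) (n : ℤ) :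
    ‖u (n - k) * ((ω n / ω (n - k) : ℝ) : ℂ)‖ ≤ ω k * ‖u (n - k)‖ := by
  have hpos : 0 < ω (n - k) := zero_lt_one.trans_le (hω.1 _)
  have hpos' : 0 < ω n := zero_lt_one.trans_le (hω.1 _)
  rw [norm_mul, Complex.norm_real, Real.norm_of_nonneg (by positivity), mul_comm]
  gcongr
  rw [div_le_iff₀ hpos]
  have := hω.2.2 k (n - k)
  rwa [show k + (n - k) = n by ring] at this

lemma shift_sum (ω : ℤ → ℝ) (k : ℤ) (u : EE) :
    HasSum (fun n => ω k * ‖u (n - k)‖) (ω k * ‖u‖) := by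
  rw [EE_norm]
  apply HasSum.mul_left
  exact ((Equiv.subRight k).hasSum_iff (f := fun n => ‖u n‖)).2 (EE_summable u).hasSum

/-- the shift operator -/
def shiftL (ω : ℤ → ℝ) (hω : IsWeightInt ω) (k : ℤ) : EE →L[ℂ] EE :=
  LinearMap.mkContinuous
    { toFun := fun u => ⟨fun n => u (n - k) * ((ω n / ω (n - k) : ℝ) : ℂ), memℓp_gen (by
        refine Summable.of_nonneg_of_le (fun n => by positivity) (fun n => ?_)
          (shift_sum ω k u).summable
        simpa using shift_bound hω k u n)⟩
      map_add' := fun u v => by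
        ext n
        simp [add_mul]
        rfl
      map_smul' := fun c u => by
        ext n
        simp [mul_assoc] } (ω k) (by
    intro u
    rw [EE_norm]
    refine hasSum_le (shift_bound hω k u) (Summable.hasSum ?_) (shift_sum ω k u)
    exact Summable.of_nonneg_of_le (fun n => by positivity) (shift_bound hω k u)
          (shift_sum ω k u).summable)

lemma shiftL_norm (ω : ℤ → ℝ) (hω : IsWeightInt ω) (k : ℤ) : ‖shiftL ω hω k‖ ≤ ω k :=
  LinearMap.mkContinuous_norm_le _ (zero_le_one.trans (hω.1 k)) _

lemma shiftL_apply (ω : ℤ → ℝ) (hω : IsWeightInt ω) (k : ℤ) (u : EE) (n : ℤ) :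
    shiftL ω hω k u n = u (n - k) * ((ω n / ω (n - k) : ℝ) : ℂ) := rfl

lemma ofEE_shiftL (ω : ℤ → ℝ) (hω : IsWeightInt ω) (k : ℤ) (u : EE) (n : ℤ) :
    ofEE ω (shiftL ω hω k u) n = ofEE ω u (n - k) := by
  have hpos : 0 < ω n := zero_lt_one.trans_le (hω.1 n)
  have h0 : (ω n : ℂ) ≠ 0 := by exact_mod_cast hpos.ne'
  rw [ofEE, shiftL_apply, ofEE]
  push_cast
  field_simp

/-- shift minus identity -/
def DL (ω : ℤ → ℝ) (hω : IsWeightInt ω) (k : ℤ) : EE →L[ℂ] EE :=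
  shiftL ω hω k - ContinuousLinearMap.id ℂ EE

lemma ofEE_DL (ω : ℤ → ℝ) (hω : IsWeightInt ω) (k : ℤ) (u : EE) (n : ℤ) :
    ofEE ω (DL ω hω k u) n = ofEE ω u (n - k) - ofEE ω u n := by
  rw [← ofEE_shiftL ω hω]
  exact congrFun ((ofEEL ω).map_sub (shiftL ω hω k u) u) n

lemma DL_summable {ω : ℤ → ℝ} (hω : IsWeightInt ω) {x : ℤ → ℂ} (hx : x ∈ l1wZ ω) :
    Summable fun k => x k • DL ω hω k := by
  refine Summable.of_norm_bounded (g := fun k => 2 * (‖x k‖ * ω k)) (Summable.mul_left 2 hx)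
    fun k => ?_
  rw [norm_smul]
  have h1 : ‖DL ω hω k‖ ≤ ω k + 1 :=
    (norm_sub_le _ _).trans (add_le_add (shiftL_norm ω hω k) ContinuousLinearMap.norm_id_le)
  have h2 := hω.1 k
  calc _ ≤ ‖x k‖ * (2 * ω k) := by gcongr; linarith
    _ = _ := by ring

lemma hasSum_ofEE {ω : ℤ → ℝ} (n : ℤ) {ι : Type*} {f : ι → EE} {u : EE} (h : HasSum f u) :
    HasSum (fun i => ofEE ω (f i) n) (ofEE ω u n) := by
  have hc : Continuous fun v : EE => v n := by
    have := (lp.evalCLM ℂ (fun _ : ℤ => ℂ) 1 n).continuous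
    exact this
  have := h.map ((LinearMap.proj n).comp (ofEEL ω)) (hc.div_const (ω n : ℂ))
  exact this

lemma ofEE_conv {ω : ℤ → ℝ} (hω : IsWeightInt ω) {x : ℤ → ℂ} (hx : x ∈ l1w0Z ω) (u : EE) :
    ofEE ω ((∑' k, x k • DL ω hω k) u) = aconv (ofEE ω u) x := by
  ext n
  have h1 := (DL_summable hω hx.1).hasSum.mapL (ContinuousLinearMap.apply ℂ EE u)
  have h2 := hasSum_ofEE (ω := ω) n h1
  have h3 : ∀ k, ofEE ω (ContinuousLinearMap.apply ℂ EE u (x k • DL ω hω k)) n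
      = ofEE ω u (n - k) * x k - ofEE ω u n * x k := by
    intro k
    have : ofEE ω (x k • (DL ω hω k u)) n = x k * ofEE ω (DL ω hω k u) n :=
      congrFun ((ofEEL ω).map_smul (x k) (DL ω hω k u)) n
    rw [ofEE_DL] at this
    simp only [ContinuousLinearMap.apply_apply, ContinuousLinearMap.smul_apply]
    rw [this]
    ring
  simp only [h3] at h2
  have hx0 : HasSum x 0 := by
    have := (l1w_summable hω hx.1).hasSum
    rwa [hx.2] at this
  have h4 := h2.add (hx0.mul_left (ofEE ω u n))
  simp only [sub_add_cancel, mul_zero, add_zero] at h4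
  rw [aconv_eq, h4.tsum_eq]
  rfl

lemma isDiff_of_finGen {ω : ℤ → ℝ} (hω : IsWeightInt ω) (h : IsFinGenIdealOfZ ω (l1w0Z ω)) :
    ∀ f ∈ l1w0Z ω, IsDiff ω f := by
  obtain ⟨N, x, hx, hI⟩ := h
  have hx0 : ∀ i, x i ∈ l1w0Z ω := by
    intro i
    rw [hI]
    refine ⟨fun _ => 0, Pi.single i 1, fun _ => l1w_finite (by simp), ?_⟩
    have h0 : ∀ y : ℤ → ℂ, aconv 0 y = 0 := fun y => by ext n; simp [aconv_eq]
    simp only [h0, zero_add]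
    rw [Finset.sum_eq_single i]
    · simp
    · intro j _ hj
      simp [Pi.single_eq_of_ne hj]
    · simp
  let d : EE := toEE ω hω (Pi.single 0 1) (single_mem ω 0 1)
  have hd : ofEE ω d = Pi.single 0 1 := ofEE_toEE _ _
  let B : (Fin N → (EE →L[ℂ] EE)) → (((Fin N → EE) × ℂ) →L[ℂ] EE) := fun C =>
    ∑ i, (C i).comp ((ContinuousLinearMap.proj i).comp (ContinuousLinearMap.fst ℂ _ _))
      + (ContinuousLinearMap.snd ℂ _ _).smulRight d
  have hB : ∀ C a c, ofEE ω (B C (a, c)) = ∑ i, ofEE ω (C i (a i)) + c • Pi.single 0 1 := by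
    intro C a c
    have : B C (a, c) = ∑ i, C i (a i) + c • d := by
      simp [B, ContinuousLinearMap.sum_apply]
    rw [this, ← hd]
    change ofEEL ω _ = ∑ i, ofEEL ω _ + c • ofEEL ω d
    simp
  have hBc : Continuous B := by
    refine Continuous.add (continuous_finsetSum _ fun i _ => ?_) continuous_const
    exact (continuous_apply i).clm_comp continuous_const
  let C : Fin N → (EE →L[ℂ] EE) := fun i => ∑' k, x i k • DL ω hω k
  have hsurj : Function.Surjective (B C) := by
    intro v
    have hm := sub_single_mem hω (ofEE_mem hω v)
    set S := ∑' n, ofEE ω v n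
    rw [hI] at hm
    obtain ⟨a, c, ha, hac⟩ := hm
    refine ⟨(fun i => toEE ω hω _ (ha i) + c i • d, S), ofEE_inj hω ?_⟩
    have hv : ofEE ω v = ∑ i, (aconv (a i) (x i) + c i • x i) + S • Pi.single 0 1 := by
      rw [← hac]
      ext n
      by_cases hn : n = 0
      · subst hn; simp
      · simp [Pi.single_eq_of_ne hn]
    rw [hB, hv]
    congr 1
    refine Finset.sum_congr rfl fun i _ => ?_
    have e1 : ofEE ω (C i (toEE ω hω _ (ha i) + c i • d)) =
        ofEE ω (C i (toEE ω hω _ (ha i))) + c i • ofEE ω (C i d) := by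
      change ofEEL ω _ = ofEEL ω _ + c i • ofEEL ω _
      simp
    rw [e1]
    simp only [C]
    rw [ofEE_conv hω (hx0 i), ofEE_conv hω (hx0 i), ofEE_toEE, hd]
    congr 2
    ext n
    rw [aconv_eq, tsum_eq_single n]
    · simp
    · intro k hk
      rw [Pi.single_eq_of_ne (by omega), zero_mul]
  have hlim : Tendsto (fun s : Finset ℤ => fun i => ∑ k ∈ s, x i k • DL ω hω k) atTop (𝓝 C) := by
    rw [tendsto_pi_nhds]
    intro i
    exact (DL_summable hω (hx i)).hasSum
  obtain ⟨s, hs⟩ := (((hBc.tendsto C).comp hlim).eventually (surj_of_close _ hsurj)).exists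
  intro f hf
  obtain ⟨⟨a, c⟩, hac⟩ := hs (toEE ω hω f hf.1)
  have hfe := congrArg (ofEE ω) hac
  rw [ofEE_toEE, Function.comp_apply, hB] at hfe
  have hdiff : IsDiff ω (∑ i, ofEE ω ((∑ k ∈ s, x i k • DL ω hω k) (a i))) := by
    refine IsDiff.sum hω _ _ fun i _ => ?_
    have : ofEE ω ((∑ k ∈ s, x i k • DL ω hω k) (a i)) =
        ∑ k ∈ s, x i k • ofEE ω (DL ω hω k (a i)) := by
      change ofEEL ω _ = ∑ k ∈ s, x i k • ofEEL ω _
      simp [ContinuousLinearMap.sum_apply]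
    rw [this]
    refine IsDiff.sum hω _ _ fun k _ => IsDiff.smul _ ?_
    have e : ofEE ω (DL ω hω k (a i)) = fun n => ofEE ω (a i) (n - k) - ofEE ω (a i) n :=
      funext fun n => ofEE_DL ω hω k (a i) n
    rw [e]
    exact IsDiff.shift hω (ofEE_mem hω _) k
  set G := ∑ i, ofEE ω ((∑ k ∈ s, x i k • DL ω hω k) (a i))
  have hG := hdiff.mem hω
  have hc : c = 0 := by
    have h1 := hf.2
    have hsm : c • (Pi.single 0 1 : ℤ → ℂ) ∈ l1wZ ω := l1w_smul c (single_mem ω 0 1)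
    have := (l1w_summable hω hG.1).tsum_add (l1w_summable hω hsm)
    rw [← hfe] at h1
    simp only [Pi.add_apply] at h1
    rw [this, hG.2, zero_add] at h1
    simpa [tsum_mul_left, tsum_pi_single] using h1
  rw [hc, zero_smul, add_zero] at hfe
  rw [← hfe]
  exact hdiff

end helpers

/-- Theorem 7.1: let `ω` be a weight on `ℤ`.  The augmentation ideal `ℓ¹₀(ℤ, ω)` is
finitely generated as an ideal of `ℓ¹(ℤ, ω)` if and only if both `(ωₙ)_{n∈ℕ}` and
`(ω₋ₙ)_{n∈ℕ}` are tail-preserving (0-indexed: the sequences `n ↦ ω (n+1)` and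
`n ↦ ω (-(n+1))`). -/
theorem stmt17 (ω : ℤ → ℝ) (hω : IsWeightInt ω) :
    IsFinGenIdealOfZ ω (l1w0Z ω) ↔
      (TailPreserving (fun n : ℕ => ω ((n : ℤ) + 1)) ∧
        TailPreserving (fun n : ℕ => ω (-((n : ℤ) + 1)))) := by
  constructor
  · intro h
    exact tail_of_isDiff hω (isDiff_of_finGen hω h)
  · rintro ⟨h1, h2⟩
    exact finGen_of_isDiff hω fun f hf => isDiff_of_tail hω h1 h2 hf
end
end
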